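/- arXiv:1612.01765 — 3 statements merged into one kernel-verified Lean document; each statement's English description precedes it below -/
import Mathlib

section
/- Let m, n be positive integers and let Ψ₁, ..., Ψₘ be nonempty bounded sets of n×n matrices with nonnegative real entries. Then ρ(Ψ₁^(1/m) ∘ ⋯ ∘ Ψₘ^(1/m)) ≤ ρ(Ψ₁Ψ₂⋯Ψₘ)^{1/m}, where ρ denotes the generalized spectral radius of a set. -/
open scoped ENNReal NNReal BigOperators

/-- Spectral radius of a real matrix: the spectral radius of the corresponding
complex matrix (equivalently, the maximum modulus of its complex eigenvalues). -/
noncomputable def specRad {n : ℕ} (A : Matrix (Fin n) (Fin n) ℝ) : ℝ≥0∞ :=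
  spectralRadius ℂ (A.map (fun x => (x : ℂ)))

/-- Operator norm of a real `n × n` matrix induced by the Euclidean norm on `ℝⁿ`. -/
noncomputable def opNorm {n : ℕ} (A : Matrix (Fin n) (Fin n) ℝ) : ℝ :=
  ‖LinearMap.toContinuousLinearMap (Matrix.toEuclideanLin A)‖

/-- The weighted Hadamard (Schur) geometric mean `A₁^(α₁) ∘ ⋯ ∘ Aₘ^(αₘ)`. -/
noncomputable def hadWMean {n m : ℕ} (α : Fin m → ℝ)
    (A : Fin m → Matrix (Fin n) (Fin n) ℝ) : Matrix (Fin n) (Fin n) ℝ :=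
  Matrix.of fun x y => ∏ j, (A j x y) ^ (α j)

/-- The ordered product `A 0 * A 1 * ⋯ * A (k-1)`. -/
def matListProd {n k : ℕ} (A : Fin k → Matrix (Fin n) (Fin n) ℝ) :
    Matrix (Fin n) (Fin n) ℝ :=
  (List.ofFn A).prod

/-- The set `Σ^k` of all products of `k` elements of `S`. -/
def setPow {n : ℕ} (S : Set (Matrix (Fin n) (Fin n) ℝ)) (k : ℕ) :
    Set (Matrix (Fin n) (Fin n) ℝ) :=
  {B | ∃ A : Fin k → Matrix (Fin n) (Fin n) ℝ, (∀ i, A i ∈ S) ∧ B = matListProd A}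

/-- The set `Ψ₁ Ψ₂ ⋯ Ψₘ` of products with the `j`-th factor from `Ψ j`. -/
def setProd {n m : ℕ} (Ψ : Fin m → Set (Matrix (Fin n) (Fin n) ℝ)) :
    Set (Matrix (Fin n) (Fin n) ℝ) :=
  {B | ∃ A : Fin m → Matrix (Fin n) (Fin n) ℝ, (∀ j, A j ∈ Ψ j) ∧ B = matListProd A}

/-- The weighted Hadamard geometric mean `Ψ₁^(α₁) ∘ ⋯ ∘ Ψₘ^(αₘ)` of sets. -/
noncomputable def setHadWMean {n m : ℕ} (α : Fin m → ℝ)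
    (Ψ : Fin m → Set (Matrix (Fin n) (Fin n) ℝ)) :
    Set (Matrix (Fin n) (Fin n) ℝ) :=
  {B | ∃ A : Fin m → Matrix (Fin n) (Fin n) ℝ, (∀ j, A j ∈ Ψ j) ∧ B = hadWMean α A}

/-- The generalized spectral radius `ρ(Σ) = limsup_{k→∞} (sup_{A ∈ Σ^k} ρ(A))^{1/k}`. -/
noncomputable def genSpecRad {n : ℕ} (S : Set (Matrix (Fin n) (Fin n) ℝ)) : ℝ≥0∞ :=
  Filter.atTop.limsup fun k : ℕ => (⨆ B ∈ setPow S k, specRad B) ^ (1 / (k : ℝ))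

/-- The joint spectral radius `ρ̂(Σ) = limsup_{k→∞} (sup_{A ∈ Σ^k} ‖A‖)^{1/k}`. -/
noncomputable def jointSpecRad {n : ℕ} (S : Set (Matrix (Fin n) (Fin n) ℝ)) : ℝ≥0∞ :=
  Filter.atTop.limsup fun k : ℕ =>
    (⨆ B ∈ setPow S k, ENNReal.ofReal (opNorm B)) ^ (1 / (k : ℝ))

/-- Hölder's inequality for finite sums and finitely many nonnegative families. -/
theorem Real.sum_prod_rpow_le_prod_sum_rpow {ι κ : Type*} [Fintype ι] [Fintype κ]
    {α : κ → ℝ} (hα : ∀ j, 0 ≤ α j) (hsum : ∑ j, α j = 1)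
    {f : κ → ι → ℝ} (hf : ∀ j x, 0 ≤ f j x) :
    ∑ x, ∏ j, f j x ^ α j ≤ ∏ j, (∑ x, f j x) ^ α j := by
  have hfs : ∀ j, 0 ≤ ∑ x, f j x := fun j => Finset.sum_nonneg fun x _ => hf j x
  have hterm : ∀ x j, 0 ≤ f j x ^ α j := fun x j => Real.rpow_nonneg (hf j x) _
  let _ : MeasurableSpace ι := ⊤
  have key := ENNReal.lintegral_prod_norm_pow_le (μ := MeasureTheory.Measure.count)
    (Finset.univ : Finset κ) (f := fun j x => ENNReal.ofReal (f j x))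
    (fun j _ => (measurable_from_top).aemeasurable) hsum (fun j _ => hα j)
  simp only [MeasureTheory.lintegral_count, tsum_fintype] at key
  rw [← ENNReal.ofReal_le_ofReal_iff
      (Finset.prod_nonneg fun j _ => Real.rpow_nonneg (hfs j) _),
    ENNReal.ofReal_sum_of_nonneg fun x _ => Finset.prod_nonneg fun j _ => hterm x j,
    ENNReal.ofReal_prod_of_nonneg fun j _ => Real.rpow_nonneg (hfs j) _]
  convert key using 2 with x _ j _
  · rw [ENNReal.ofReal_prod_of_nonneg fun j _ => hterm x j]
    exact Finset.prod_congr rfl fun j _ =>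
      (ENNReal.ofReal_rpow_of_nonneg (hf j x) (hα j)).symm
  · rw [← ENNReal.ofReal_rpow_of_nonneg (hfs j) (hα j),
      ENNReal.ofReal_sum_of_nonneg fun x _ => hf j x]

section Entrywise

variable {n m : ℕ}

theorem list_prod_entries_nonneg (l : List (Matrix (Fin n) (Fin n) ℝ))
    (hl : ∀ A ∈ l, ∀ x y, 0 ≤ A x y) (x y : Fin n) : 0 ≤ l.prod x y := by
  induction l generalizing x y with
  | nil => rw [List.prod_nil, Matrix.one_apply]; split_ifs <;> norm_num
  | cons A l ih =>
    rw [List.prod_cons, Matrix.mul_apply]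
    exact Finset.sum_nonneg fun z _ => mul_nonneg (hl A (by simp) x z)
      (ih (fun B hB => hl B (by simp [hB])) z y)

theorem matListProd_nonneg {k : ℕ} (A : Fin k → Matrix (Fin n) (Fin n) ℝ)
    (hA : ∀ i x y, 0 ≤ A i x y) (x y : Fin n) : 0 ≤ matListProd A x y :=
  list_prod_entries_nonneg _ (by simpa [List.mem_ofFn] using hA) x y

theorem matListProd_succ {k : ℕ} (A : Fin (k + 1) → Matrix (Fin n) (Fin n) ℝ) :
    matListProd A = A 0 * matListProd fun i => A i.succ := by
  simp [matListProd, List.ofFn_succ]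

theorem matListProd_const (k : ℕ) (A : Matrix (Fin n) (Fin n) ℝ) :
    matListProd (fun _ : Fin k => A) = A ^ k := by
  simp [matListProd]

theorem hadWMean_nonneg {α : Fin m → ℝ} {A : Fin m → Matrix (Fin n) (Fin n) ℝ}
    (hA : ∀ j x y, 0 ≤ A j x y) (x y : Fin n) : 0 ≤ hadWMean α A x y := by
  rw [hadWMean, Matrix.of_apply]
  exact Finset.prod_nonneg fun j _ => Real.rpow_nonneg (hA j x y) _

/-- A product of Hadamard geometric means is dominated entrywise by the Hadamard geometric mean
of the products. -/
theorem matListProd_hadWMean_le {α : Fin m → ℝ} (hα : ∀ j, 0 ≤ α j) (hsum : ∑ j, α j = 1)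
    {k : ℕ} (A : Fin k → Fin m → Matrix (Fin n) (Fin n) ℝ)
    (hA : ∀ i j x y, 0 ≤ A i j x y) (x y : Fin n) :
    matListProd (fun i => hadWMean α (A i)) x y ≤
      hadWMean α (fun j => matListProd fun i => A i j) x y := by
  induction k generalizing x y with
  | zero =>
    by_cases hxy : x = y
    · subst hxy; simp [matListProd, hadWMean]
    · have h0 : matListProd (fun i : Fin 0 => hadWMean α (A i)) x y = 0 := by
        simp [matListProd, hxy]
      rw [h0]
      exact hadWMean_nonneg (fun j => matListProd_nonneg _ fun i => hA i j) x y
  | succ k ih =>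
    have hP : ∀ j x y, 0 ≤ matListProd (fun i : Fin k => A i.succ j) x y :=
      fun j => matListProd_nonneg _ fun i => hA i.succ j
    simp only [matListProd_succ, Matrix.mul_apply]
    calc ∑ z, hadWMean α (A 0) x z * matListProd (fun i : Fin k => hadWMean α (A i.succ)) z y
        ≤ ∑ z, hadWMean α (A 0) x z *
            hadWMean α (fun j => matListProd fun i : Fin k => A i.succ j) z y := by
          gcongr with z
          · exact hadWMean_nonneg (hA 0) x z
          · exact ih (fun i => A i.succ) (fun i => hA i.succ) z y
      _ = ∑ z, ∏ j, (A 0 j x z * matListProd (fun i : Fin k => A i.succ j) z y) ^ α j := by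
          refine Finset.sum_congr rfl fun z _ => ?_
          simp only [hadWMean, Matrix.of_apply, ← Finset.prod_mul_distrib]
          exact Finset.prod_congr rfl fun j _ => (Real.mul_rpow (hA 0 j x z) (hP j z y)).symm
      _ ≤ ∏ j, (∑ z, A 0 j x z * matListProd (fun i : Fin k => A i.succ j) z y) ^ α j :=
          Real.sum_prod_rpow_le_prod_sum_rpow hα hsum
            fun j z => mul_nonneg (hA 0 j x z) (hP j z y)
      _ = _ := by simp [hadWMean, Matrix.mul_apply]

theorem pow_entries_le_pow {M N : Matrix (Fin n) (Fin n) ℝ} (hM : ∀ x y, 0 ≤ M x y)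
    (hMN : ∀ x y, M x y ≤ N x y) (k : ℕ) (x y : Fin n) :
    0 ≤ (M ^ k) x y ∧ (M ^ k) x y ≤ (N ^ k) x y := by
  induction k generalizing x y with
  | zero => rw [pow_zero, pow_zero, Matrix.one_apply]; split_ifs <;> norm_num
  | succ k ih =>
    rw [pow_succ, pow_succ, Matrix.mul_apply, Matrix.mul_apply]
    exact ⟨Finset.sum_nonneg fun z _ => mul_nonneg (ih x z).1 (hM z y),
      Finset.sum_le_sum fun z _ => mul_le_mul (ih x z).2 (hMN z y) (hM z y)
        ((ih x z).1.trans (ih x z).2)⟩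

end Entrywise

section SpectralRadius

variable {n m : ℕ}

attribute [local instance] Matrix.linftyOpNormedRing Matrix.linftyOpNormedAlgebra

theorem nnnorm_map_ofReal_le_iff {M : Matrix (Fin n) (Fin n) ℝ} (hM : ∀ x y, 0 ≤ M x y)
    {c : ℝ≥0} :
    ‖M.map (fun x => (x : ℂ))‖₊ ≤ c ↔ ∀ x, ∑ y, M x y ≤ c := by
  rw [Matrix.linfty_opNNNorm_def, Finset.sup_le_iff]
  refine ⟨fun h x => ?_, fun h x _ => ?_⟩
  · have := NNReal.coe_le_coe.2 (h x (Finset.mem_univ x))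
    simpa [abs_of_nonneg (hM _ _)] using this
  · rw [← NNReal.coe_le_coe]
    simpa [abs_of_nonneg (hM _ _)] using h x

theorem nnnorm_map_le_prod_of_le_hadWMean {α : Fin m → ℝ} (hα : ∀ j, 0 ≤ α j)
    (hsum : ∑ j, α j = 1) {M : Matrix (Fin n) (Fin n) ℝ}
    {P : Fin m → Matrix (Fin n) (Fin n) ℝ} (hM : ∀ x y, 0 ≤ M x y)
    (hP : ∀ j x y, 0 ≤ P j x y) (hle : ∀ x y, M x y ≤ hadWMean α P x y) :
    ‖M.map (fun x => (x : ℂ))‖₊ ≤ ∏ j, ‖(P j).map (fun x => (x : ℂ))‖₊ ^ α j := by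
  rw [nnnorm_map_ofReal_le_iff hM]
  intro x
  calc ∑ y, M x y ≤ ∑ y, ∏ j, P j x y ^ α j := Finset.sum_le_sum fun y _ => hle x y
    _ ≤ ∏ j, (∑ y, P j x y) ^ α j :=
        Real.sum_prod_rpow_le_prod_sum_rpow hα hsum fun j y => hP j x y
    _ ≤ ∏ j, (‖(P j).map (fun x => (x : ℂ))‖₊ : ℝ) ^ α j := by
        refine Finset.prod_le_prod
          (fun j _ => Real.rpow_nonneg (Finset.sum_nonneg fun y _ => hP j x y) _)
          fun j _ => Real.rpow_le_rpow (Finset.sum_nonneg fun y _ => hP j x y) ?_ (hα j)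
        exact (nnnorm_map_ofReal_le_iff (hP j)).1 le_rfl x
    _ = _ := by push_cast; rfl

theorem map_ofReal_pow (M : Matrix (Fin n) (Fin n) ℝ) (k : ℕ) :
    (M ^ k).map (fun x => (x : ℂ)) = (M.map (fun x => (x : ℂ))) ^ k :=
  map_pow (Complex.ofRealHom.mapMatrix (m := Fin n)) M k

theorem map_ofReal_mul (M N : Matrix (Fin n) (Fin n) ℝ) :
    (M * N).map (fun x => (x : ℂ)) = M.map (fun x => (x : ℂ)) * N.map (fun x => (x : ℂ)) :=
  map_mul (Complex.ofRealHom.mapMatrix (m := Fin n)) M N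

theorem specRad_tendsto (M : Matrix (Fin n) (Fin n) ℝ) :
    Filter.Tendsto (fun k : ℕ => (‖(M ^ k).map (fun x => (x : ℂ))‖₊ : ℝ≥0∞) ^ (1 / k : ℝ))
      Filter.atTop (nhds (specRad M)) := by
  simp only [map_ofReal_pow]
  exact spectrum.pow_nnnorm_pow_one_div_tendsto_nhds_spectralRadius _

theorem specRad_ne_top (M : Matrix (Fin n) (Fin n) ℝ) : specRad M ≠ ⊤ := by
  have h := spectrum.spectralRadius_le_pow_nnnorm_pow_one_div ℂ (M.map (fun x => (x : ℂ))) 0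
  refine ne_top_of_le_ne_top ?_ h
  simp [ENNReal.mul_eq_top]

/-- The spectral radius of a matrix dominated by a Hadamard geometric mean is at most the
geometric mean of the spectral radii. -/
theorem specRad_le_prod_of_le_hadWMean {α : Fin m → ℝ} (hα : ∀ j, 0 ≤ α j)
    (hsum : ∑ j, α j = 1) {M : Matrix (Fin n) (Fin n) ℝ}
    {P : Fin m → Matrix (Fin n) (Fin n) ℝ} (hM : ∀ x y, 0 ≤ M x y)
    (hP : ∀ j x y, 0 ≤ P j x y) (hle : ∀ x y, M x y ≤ hadWMean α P x y) :
    specRad M ≤ ∏ j, specRad (P j) ^ α j := by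
  refine le_of_tendsto_of_tendsto' (specRad_tendsto M)
    (ENNReal.tendsto_finsetProd_of_ne_top Finset.univ
      (fun j _ => (specRad_tendsto (P j)).ennrpow_const (α j))
      fun j _ => ENNReal.rpow_ne_top_of_nonneg (hα j) (specRad_ne_top _)) fun k => ?_
  have hk : (0 : ℝ) ≤ 1 / k := by positivity
  have hPk : ∀ j x y, 0 ≤ (P j ^ k) x y :=
    fun j x y => (pow_entries_le_pow (hP j) (fun _ _ => le_rfl) k x y).1
  have hMk : ∀ x y, (M ^ k) x y ≤ hadWMean α (fun j => P j ^ k) x y := fun x y => by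
    refine (pow_entries_le_pow hM hle k x y).2.trans ?_
    simpa only [matListProd_const] using
      matListProd_hadWMean_le hα hsum (fun _ : Fin k => P) (fun _ => hP) x y
  have hnn := nnnorm_map_le_prod_of_le_hadWMean hα hsum
    (fun x y => (pow_entries_le_pow hM hle k x y).1) hPk hMk
  calc (‖(M ^ k).map (fun x => (x : ℂ))‖₊ : ℝ≥0∞) ^ (1 / k : ℝ)
      ≤ (∏ j, (‖(P j ^ k).map (fun x => (x : ℂ))‖₊ : ℝ≥0∞) ^ α j) ^ (1 / k : ℝ) := by
        refine ENNReal.rpow_le_rpow ((ENNReal.coe_le_coe.2 hnn).trans_eq ?_) hk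
        rw [ENNReal.ofNNReal_finsetProd]
        exact Finset.prod_congr rfl fun j _ => (ENNReal.coe_rpow_of_nonneg _ (hα j))
    _ = _ := by
        rw [← ENNReal.prod_rpow_of_nonneg hk]
        exact Finset.prod_congr rfl fun j _ => by
          rw [← ENNReal.rpow_mul, ← ENNReal.rpow_mul, mul_comm]

theorem specRad_pow_le (M : Matrix (Fin n) (Fin n) ℝ) {k : ℕ} (hk : k ≠ 0) :
    specRad M ^ k ≤ specRad (M ^ k) := by
  rw [specRad, specRad, map_ofReal_pow]
  exact spectrum.spectralRadius_pow_le _ k hk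

theorem specRad_mul_comm (M N : Matrix (Fin n) (Fin n) ℝ) :
    specRad (M * N) = specRad (N * M) := by
  suffices h : ∀ A B : Matrix (Fin n) (Fin n) ℂ,
      spectralRadius ℂ (A * B) ≤ spectralRadius ℂ (B * A) by
    rw [specRad, specRad, map_ofReal_mul, map_ofReal_mul]
    exact le_antisymm (h _ _) (h _ _)
  refine fun A B => iSup₂_le fun z hz => ?_
  rcases eq_or_ne z 0 with rfl | hz0
  · simp
  · have hz' : z ∈ spectrum ℂ (A * B) \ {0} := ⟨hz, hz0⟩
    rw [spectrum.nonzero_mul_comm] at hz'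
    exact le_iSup₂ (f := fun (z : ℂ) (_ : z ∈ spectrum ℂ (B * A)) => (‖z‖₊ : ℝ≥0∞)) z hz'.1

theorem specRad_prod_rotate (l : List (Matrix (Fin n) (Fin n) ℝ)) (r : ℕ) :
    specRad (l.rotate r).prod = specRad l.prod := by
  rw [List.rotate_eq_drop_append_take_mod, List.prod_append, specRad_mul_comm,
    ← List.prod_append, List.take_append_drop]

end SpectralRadius

section SetProducts

variable {n m : ℕ}

theorem mem_setPow_iff {S : Set (Matrix (Fin n) (Fin n) ℝ)} {k : ℕ}
    {B : Matrix (Fin n) (Fin n) ℝ} :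
    B ∈ setPow S k ↔ ∃ l : List (Matrix (Fin n) (Fin n) ℝ),
      l.length = k ∧ (∀ A ∈ l, A ∈ S) ∧ l.prod = B := by
  constructor
  · rintro ⟨A, hA, rfl⟩
    exact ⟨List.ofFn A, by simp, by simpa [List.mem_ofFn] using hA, rfl⟩
  · rintro ⟨l, rfl, hl, rfl⟩
    exact ⟨l.get, fun i => hl _ (List.get_mem l i), by rw [matListProd, List.ofFn_get]⟩

theorem pow_mem_setPow {S : Set (Matrix (Fin n) (Fin n) ℝ)} {k : ℕ}
    {B : Matrix (Fin n) (Fin n) ℝ} (hB : B ∈ setPow S k) (r : ℕ) :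
    B ^ r ∈ setPow S (r * k) := by
  obtain ⟨l, rfl, hl, rfl⟩ := mem_setPow_iff.1 hB
  refine mem_setPow_iff.2 ⟨(List.replicate r l).flatten, by simp, fun A hA => ?_, by simp⟩
  obtain ⟨l', hl', hA'⟩ := List.mem_flatten.1 hA
  exact hl A (List.eq_of_mem_replicate hl' ▸ hA')

theorem prod_mem_setPow_setProd (hm : 0 < m) {Ψ : Fin m → Set (Matrix (Fin n) (Fin n) ℝ)}
    {k : ℕ} {l : List (Matrix (Fin n) (Fin n) ℝ)} (hlen : l.length = k * m)
    (hl : ∀ (i : ℕ) (hi : i < l.length), l[i] ∈ Ψ ⟨i % m, Nat.mod_lt i hm⟩) :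
    l.prod ∈ setPow (setProd Ψ) k := by
  obtain ⟨F, hF⟩ : ∃ F : Fin (k * m) → Matrix (Fin n) (Fin n) ℝ, l = List.ofFn F :=
    ⟨fun i => l[i.1]'(hlen.symm ▸ i.2 : i.1 < l.length), List.ext_getElem (by simpa using hlen) (by simp)⟩
  subst hF
  rw [List.ofFn_mul, List.prod_flatten, List.map_ofFn]
  refine ⟨_, fun i => ⟨_, fun j => ?_, rfl⟩, rfl⟩
  have hlt : i.1 * m + j.1 < k * m :=
    calc i.1 * m + j.1 < (i.1 + 1) * m := by rw [add_mul, one_mul]; exact Nat.add_lt_add_left j.2 _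
      _ ≤ k * m := Nat.mul_le_mul_right _ i.2
  have h := hl (i.1 * m + j.1) (by simpa using hlt)
  have hj : (⟨(i.1 * m + j.1) % m, Nat.mod_lt _ hm⟩ : Fin m) = j :=
    Fin.ext ((Nat.mul_add_mod' _ _ _).trans (Nat.mod_eq_of_lt j.2))
  rw [hj, List.getElem_ofFn] at h
  exact h

/-- A product whose factors run cyclically through `Ψ`, starting from any index, has the spectral
radius of an element of `(Ψ₁ ⋯ Ψₘ)^k`. -/
theorem exists_mem_setPow_setProd_specRad_eq (hm : 0 < m)
    {Ψ : Fin m → Set (Matrix (Fin n) (Fin n) ℝ)} {k : ℕ} (s : Fin m)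
    (F : Fin (k * m) → Matrix (Fin n) (Fin n) ℝ)
    (hF : ∀ i : Fin (k * m), F i ∈ Ψ ⟨(i.1 + s.1) % m, Nat.mod_lt _ hm⟩) :
    ∃ Q ∈ setPow (setProd Ψ) k, specRad (matListProd F) = specRad Q := by
  refine ⟨((List.ofFn F).rotate (m - s.1)).prod,
    prod_mem_setPow_setProd hm (by simp) fun i hi => ?_, (specRad_prod_rotate _ _).symm⟩
  rw [List.getElem_rotate, List.getElem_ofFn]
  convert hF _ using 3
  have hs := s.2
  simp only [List.length_ofFn]
  rw [Nat.add_mod, Nat.mod_mul_left_mod, ← Nat.add_mod, add_assoc, Nat.sub_add_cancel hs.le,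
    Nat.add_mod_right]

theorem hadWMean_const_comp_equiv (c : ℝ) (A : Fin m → Matrix (Fin n) (Fin n) ℝ)
    (e : Fin m ≃ Fin m) : hadWMean (fun _ => c) (fun j => A (e j)) = hadWMean (fun _ => c) A := by
  ext x y
  exact Equiv.prod_comp e fun j => A j x y ^ c

theorem specRad_le_iSup_setPow_setProd (hm : 0 < m)
    {Ψ : Fin m → Set (Matrix (Fin n) (Fin n) ℝ)}
    (hpos : ∀ j, ∀ B ∈ Ψ j, ∀ x y, 0 ≤ B x y) {k : ℕ} {B : Matrix (Fin n) (Fin n) ℝ}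
    (hB : B ∈ setPow (setHadWMean (fun _ => 1 / (m : ℝ)) Ψ) (k * m)) :
    specRad B ≤ ⨆ Q ∈ setPow (setProd Ψ) k, specRad Q := by
  have : NeZero m := ⟨hm.ne'⟩
  have hm0 : (m : ℝ) ≠ 0 := by exact_mod_cast hm.ne'
  have hα : ∀ _ : Fin m, 0 ≤ 1 / (m : ℝ) := fun _ => by positivity
  have hsum : ∑ _ : Fin m, 1 / (m : ℝ) = 1 := by simp [hm0]
  obtain ⟨C, hC, rfl⟩ := hB
  choose A hA hCA using hC
  let A' : Fin (k * m) → Fin m → Matrix (Fin n) (Fin n) ℝ :=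
    fun i s => A i ⟨(i.1 + s.1) % m, Nat.mod_lt _ hm⟩
  have hA' : ∀ i s x y, 0 ≤ A' i s x y := fun i s => hpos _ _ (hA i _)
  have hCA' : C = fun i => hadWMean (fun _ => 1 / (m : ℝ)) (A' i) := by
    funext i
    rw [hCA i, ← hadWMean_const_comp_equiv _ (A i) (Equiv.addLeft (Fin.ofNat m i.1))]
    congr 1
    funext s
    simp only [A', Equiv.coe_addLeft]
    congr 1
    ext
    simp [Fin.val_add]
  rw [hCA']
  calc specRad (matListProd fun i => hadWMean (fun _ => 1 / (m : ℝ)) (A' i))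
      ≤ ∏ s, specRad (matListProd fun i => A' i s) ^ (1 / (m : ℝ)) :=
        specRad_le_prod_of_le_hadWMean hα hsum
          (matListProd_nonneg _ fun i => hadWMean_nonneg (hA' i))
          (fun s => matListProd_nonneg _ fun i => hA' i s)
          (matListProd_hadWMean_le hα hsum A' hA')
    _ ≤ ∏ _s : Fin m, (⨆ Q ∈ setPow (setProd Ψ) k, specRad Q) ^ (1 / (m : ℝ)) := by
        refine Finset.prod_le_prod' fun s _ => ENNReal.rpow_le_rpow ?_ (hα s)
        obtain ⟨Q, hQ, hs⟩ := exists_mem_setPow_setProd_specRad_eq hm s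
          (fun i => A' i s) (fun i => hA i _)
        rw [hs]
        exact le_iSup₂ (f := fun Q (_ : Q ∈ setPow (setProd Ψ) k) => specRad Q) Q hQ
    _ = _ := by
        rw [Finset.prod_const, Finset.card_univ, Fintype.card_fin, ← ENNReal.rpow_natCast,
          ← ENNReal.rpow_mul, one_div_mul_cancel hm0, ENNReal.rpow_one]

end SetProducts

/-- Theorem 3.4, inequality (12), for bounded sets of non-negative matrices:
`ρ(Ψ₁^(1/m) ∘ ⋯ ∘ Ψₘ^(1/m)) ≤ ρ(Ψ₁ Ψ₂ ⋯ Ψₘ)^(1/m)` for the generalized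
spectral radius. -/
theorem genSpecRad_setHadGeomMean_le {m n : ℕ} (hm : 0 < m) (hn : 0 < n)
    (Ψ : Fin m → Set (Matrix (Fin n) (Fin n) ℝ))
    (hne : ∀ j, (Ψ j).Nonempty)
    (hbdd : ∀ j, ∃ C : ℝ, ∀ B ∈ Ψ j, opNorm B ≤ C)
    (hpos : ∀ j, ∀ B ∈ Ψ j, ∀ x y, 0 ≤ B x y) :
    genSpecRad (setHadWMean (fun _ => 1 / (m : ℝ)) Ψ) ≤
      genSpecRad (setProd Ψ) ^ (1 / (m : ℝ)) := by
  have hm0 : (m : ℝ) ≠ 0 := by exact_mod_cast hm.ne'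
  have hm' : (0 : ℝ) < 1 / (m : ℝ) := by positivity
  rw [genSpecRad, genSpecRad, ← ENNReal.orderIsoRpow_apply _ hm', OrderIso.limsup_apply]
  refine Filter.limsup_le_limsup (Filter.Eventually.of_forall fun k => ?_)
  simp only [ENNReal.orderIsoRpow_apply]
  rw [← ENNReal.rpow_mul, mul_comm (1 / (k : ℝ)), ENNReal.rpow_mul]
  refine ENNReal.rpow_le_rpow (iSup₂_le fun B hB => ?_) (by positivity)
  rw [one_div, ENNReal.le_rpow_inv_iff (by positivity), ENNReal.rpow_natCast]
  refine (specRad_pow_le B hm.ne').trans (specRad_le_iSup_setPow_setProd hm hpos ?_)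
  rw [mul_comm k m]
  exact pow_mem_setPow hB m
end

section
/- Let m, n be positive integers and let Ψ₁, ..., Ψₘ be nonempty bounded sets of n×n matrices with nonnegative real entries. Then ρ̂(Ψ₁^(1/m) ∘ ⋯ ∘ Ψₘ^(1/m)) ≤ ρ̂(Ψ₁Ψ₂⋯Ψₘ)^{1/m}, where ρ̂ denotes the joint spectral radius of a set. -/
open scoped ENNReal NNReal BigOperators

section OperatorNorm

variable {n : ℕ}

theorem opNorm_nonneg (A : Matrix (Fin n) (Fin n) ℝ) : 0 ≤ opNorm A := norm_nonneg _

open scoped Matrix.Norms.L2Operator in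
theorem opNorm_mul_le (A B : Matrix (Fin n) (Fin n) ℝ) : opNorm (A * B) ≤ opNorm A * opNorm B :=
  Matrix.l2_opNorm_mul A B

theorem opNorm_one_le : opNorm (1 : Matrix (Fin n) (Fin n) ℝ) ≤ 1 := by
  refine ContinuousLinearMap.opNorm_le_bound _ zero_le_one fun v => ?_
  simp

theorem abs_entry_le_opNorm (A : Matrix (Fin n) (Fin n) ℝ) (x y : Fin n) :
    |A x y| ≤ opNorm A := by
  have h := ContinuousLinearMap.le_opNorm
    (LinearMap.toContinuousLinearMap (Matrix.toEuclideanLin A)) (EuclideanSpace.single y 1)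
  have h' := PiLp.norm_apply_le (LinearMap.toContinuousLinearMap (Matrix.toEuclideanLin A)
    (EuclideanSpace.single y 1)) x
  simp [Matrix.toLpLin_apply] at h h'
  exact h'.trans h

theorem opNorm_le_of_abs_entry_le (A : Matrix (Fin n) (Fin n) ℝ) {c : ℝ} (hc : 0 ≤ c)
    (h : ∀ x y, |A x y| ≤ c) : opNorm A ≤ n ^ 2 * c := by
  refine ContinuousLinearMap.opNorm_le_bound _ (by positivity) fun v => ?_
  have hentry : ∀ x, ‖(A.mulVec v.ofLp) x‖ ≤ n * (c * ‖v‖) := fun x => by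
    calc ‖∑ y, A x y * v y‖ ≤ ∑ y, ‖A x y * v y‖ := norm_sum_le _ _
      _ ≤ ∑ _y : Fin n, c * ‖v‖ := by
        refine Finset.sum_le_sum fun y _ => ?_
        rw [norm_mul]
        exact mul_le_mul (h x y) (PiLp.norm_apply_le v y) (norm_nonneg _) hc
      _ = n * (c * ‖v‖) := by simp
  have hsum : ∀ w : EuclideanSpace ℝ (Fin n), ‖w‖ ≤ ∑ x, ‖w x‖ := fun w => by
    rw [EuclideanSpace.norm_eq]
    refine Real.sqrt_le_iff.2 ⟨by positivity, ?_⟩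
    exact Finset.sum_sq_le_sq_sum_of_nonneg fun _ _ => norm_nonneg _
  calc ‖Matrix.toEuclideanLin A v‖ ≤ ∑ x, ‖Matrix.toEuclideanLin A v x‖ := hsum _
    _ ≤ ∑ _x : Fin n, n * (c * ‖v‖) := Finset.sum_le_sum fun x _ => by
        simpa [Matrix.toLpLin_apply] using hentry x
    _ = n ^ 2 * c * ‖v‖ := by simp; ring

end OperatorNorm

/-- **Hölder's inequality** for finitely many functions with equal exponents. -/
theorem sum_prod_rpow_le_prod_sum_rpow {ι κ : Type*} (s : Finset ι) (t : Finset κ) (w : κ → ℝ)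
    (hw : ∀ j ∈ t, 0 < w j) (hw1 : ∑ j ∈ t, w j = 1) (f : κ → ι → ℝ)
    (hf : ∀ j ∈ t, ∀ i ∈ s, 0 ≤ f j i) :
    ∑ i ∈ s, ∏ j ∈ t, f j i ^ w j ≤ ∏ j ∈ t, (∑ i ∈ s, f j i) ^ w j := by
  have hS : ∀ j ∈ t, 0 ≤ ∑ i ∈ s, f j i := fun j hj => Finset.sum_nonneg (hf j hj)
  by_cases h0 : ∃ j ∈ t, ∑ i ∈ s, f j i = 0
  · obtain ⟨j, hj, hj0⟩ := h0
    have hz := (Finset.sum_eq_zero_iff_of_nonneg (hf j hj)).1 hj0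
    rw [Finset.sum_eq_zero]
    · exact Finset.prod_nonneg fun j hj => Real.rpow_nonneg (hS j hj) _
    · intro i hi
      exact Finset.prod_eq_zero hj (by rw [hz i hi, Real.zero_rpow (hw j hj).ne'])
  push Not at h0
  set S : κ → ℝ := fun j => ∑ i ∈ s, f j i
  have hterm : ∀ i ∈ s, ∏ j ∈ t, f j i ^ w j ≤
      (∏ j ∈ t, S j ^ w j) * ∑ j ∈ t, w j * (f j i / S j) := fun i hi => by
    have h := Real.geom_mean_le_arith_mean_weighted t w (fun j => f j i / S j)
      (fun j hj => (hw j hj).le) hw1 (fun j hj => div_nonneg (hf j hj i hi) (hS j hj))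
    refine le_trans (le_of_eq ?_) (mul_le_mul_of_nonneg_left h
      (Finset.prod_nonneg fun j hj => Real.rpow_nonneg (hS j hj) _))
    rw [← Finset.prod_mul_distrib]
    refine Finset.prod_congr rfl fun j hj => ?_
    rw [← Real.mul_rpow (hS j hj) (div_nonneg (hf j hj i hi) (hS j hj)),
      mul_div_cancel₀ _ (h0 j hj)]
  refine (Finset.sum_le_sum hterm).trans_eq ?_
  rw [← Finset.mul_sum, Finset.sum_comm]
  have : ∑ j ∈ t, ∑ i ∈ s, w j * (f j i / S j) = 1 := by
    rw [← hw1]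
    refine Finset.sum_congr rfl fun j hj => ?_
    rw [← Finset.mul_sum, ← Finset.sum_div, div_self (h0 j hj), mul_one]
  rw [this, mul_one]

/-- The ordered product `f 0 * f 1 * ⋯ * f (k-1)` of a prefix of a sequence. -/
def seqProd {M : Type*} [Monoid M] (f : ℕ → M) : ℕ → M
  | 0 => 1
  | k + 1 => seqProd f k * f k

theorem seqProd_add {M : Type*} [Monoid M] (f : ℕ → M) (a b : ℕ) :
    seqProd f (a + b) = seqProd f a * seqProd (fun i => f (a + i)) b := by
  induction b with
  | zero => simp [seqProd]
  | succ b ih => rw [← add_assoc, seqProd, ih, seqProd, mul_assoc]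

theorem seqProd_mul {M : Type*} [Monoid M] (f : ℕ → M) (k m : ℕ) :
    seqProd f (k * m) = seqProd (fun l => seqProd (fun i => f (l * m + i)) m) k := by
  induction k with
  | zero => simp [seqProd]
  | succ k ih => rw [Nat.succ_mul, seqProd_add, ih, seqProd]

theorem list_prod_ofFn_eq_seqProd {M : Type*} [Monoid M] (f : ℕ → M) (k : ℕ) :
    (List.ofFn fun i : Fin k => f i).prod = seqProd f k := by
  induction k with
  | zero => simp [seqProd]
  | succ k ih =>
    rw [List.ofFn_succ', List.concat_eq_append, List.prod_append, seqProd, ← ih]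
    simp

theorem opNorm_seqProd_le {n : ℕ} {f : ℕ → Matrix (Fin n) (Fin n) ℝ} {c : ℝ} (hc : 0 ≤ c)
    (hf : ∀ i, opNorm (f i) ≤ c) (k : ℕ) : opNorm (seqProd f k) ≤ c ^ k := by
  induction k with
  | zero => simpa [seqProd] using opNorm_one_le
  | succ k ih =>
    rw [seqProd, pow_succ]
    exact (opNorm_mul_le _ _).trans (mul_le_mul ih (hf k) (opNorm_nonneg _) (by positivity))

theorem seqProd_entry_nonneg {n : ℕ} {f : ℕ → Matrix (Fin n) (Fin n) ℝ}
    (hf : ∀ i x y, 0 ≤ f i x y) (k : ℕ) (x y : Fin n) : 0 ≤ seqProd f k x y := by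
  induction k generalizing y with
  | zero => simp only [seqProd, Matrix.one_apply]; split_ifs <;> norm_num
  | succ k ih =>
    rw [seqProd, Matrix.mul_apply]
    exact Finset.sum_nonneg fun z _ => mul_nonneg (ih z) (hf k z y)

theorem hadWMean_entry_nonneg {m n : ℕ} (α : Fin m → ℝ) {A : Fin m → Matrix (Fin n) (Fin n) ℝ}
    (hA : ∀ j x y, 0 ≤ A j x y) (x y : Fin n) : 0 ≤ hadWMean α A x y := by
  rw [hadWMean, Matrix.of_apply]
  exact Finset.prod_nonneg fun j _ => Real.rpow_nonneg (hA j x y) _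

/-- A product of Hadamard geometric means is dominated entrywise by the Hadamard geometric mean
of the products. -/
theorem seqProd_hadWMean_entry_le {m n : ℕ} (α : Fin m → ℝ) (hα : ∀ j, 0 < α j)
    (hα1 : ∑ j, α j = 1) (g : Fin m → ℕ → Matrix (Fin n) (Fin n) ℝ)
    (hg : ∀ j i x y, 0 ≤ g j i x y) (k : ℕ) (x y : Fin n) :
    seqProd (fun i => hadWMean α fun j => g j i) k x y ≤
      hadWMean α (fun j => seqProd (g j) k) x y := by
  induction k generalizing y with
  | zero =>
    by_cases h : x = y
    · subst h
      simp [seqProd, hadWMean]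
    · simpa [seqProd, h] using hadWMean_entry_nonneg α (A := fun _ => 1) (fun _ x y => by
        rw [Matrix.one_apply]; split_ifs <;> norm_num) x y
  | succ k ih =>
    calc ∑ z, seqProd (fun i => hadWMean α fun j => g j i) k x z * hadWMean α (fun j => g j k) z y
        ≤ ∑ z, ∏ j, (seqProd (g j) k x z * g j k z y) ^ α j := by
          refine Finset.sum_le_sum fun z _ => ?_
          refine (mul_le_mul_of_nonneg_right (ih z)
            (hadWMean_entry_nonneg α (fun j => hg j k) z y)).trans_eq ?_
          simp only [hadWMean, Matrix.of_apply]
          rw [← Finset.prod_mul_distrib]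
          exact Finset.prod_congr rfl fun j _ =>
            (Real.mul_rpow (seqProd_entry_nonneg (hg j) k x z) (hg j k z y)).symm
      _ ≤ ∏ j, (∑ z, seqProd (g j) k x z * g j k z y) ^ α j :=
          sum_prod_rpow_le_prod_sum_rpow _ _ α (fun j _ => hα j) hα1 _ fun j _ z _ =>
            mul_nonneg (seqProd_entry_nonneg (hg j) k x z) (hg j k z y)

/-- The norm of a product of Hadamard geometric means is controlled by the norm of a product of
elements of `Ψ₁ ⋯ Ψₘ`. -/
theorem exists_mem_setPow_setProd_opNorm_le {m n N : ℕ} (hm : 0 < m)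
    {Ψ : Fin m → Set (Matrix (Fin n) (Fin n) ℝ)} {c : ℝ} (hc : 1 ≤ c)
    (hbdd : ∀ j, ∀ B ∈ Ψ j, opNorm B ≤ c) (hpos : ∀ j, ∀ B ∈ Ψ j, ∀ x y, 0 ≤ B x y)
    (hN : m ≤ N) {B : Matrix (Fin n) (Fin n) ℝ}
    (hB : B ∈ setPow (setHadWMean (fun _ => 1 / (m : ℝ)) Ψ) N) :
    ∃ Y ∈ setPow (setProd Ψ) (N / m - 1), opNorm B ≤ n ^ 2 * c ^ (2 * m) * opNorm Y := by
  obtain ⟨A, hA, rfl⟩ := hB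
  choose C hC hCA using hA
  have hN0 : 0 < N := hm.trans_le hN
  have hc0 : 0 ≤ c := zero_le_one.trans hc
  set k := N / m - 1 with hk
  have hNk : m * k + m + N % m = N := by
    have h1 : 0 < N / m := Nat.div_pos hN hm
    have h2 : k + 1 = N / m := by omega
    rw [← Nat.mul_succ, Nat.succ_eq_add_one, h2, Nat.div_add_mod]
  have hmod : N % m < m := Nat.mod_lt _ hm
  let σ : ℕ → Fin m → Fin m := fun i s => ⟨(i + s) % m, Nat.mod_lt _ hm⟩
  have hσ : ∀ i, Function.Bijective (σ i) := fun i => by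
    refine Finite.injective_iff_bijective.1 fun s s' h => Fin.ext ?_
    have h' : i + s ≡ i + s' [MOD m] := congrArg Fin.val h
    exact (Nat.ModEq.add_left_cancel' i h').eq_of_lt_of_lt s.2 s'.2
  let g : Fin m → ℕ → Matrix (Fin n) (Fin n) ℝ :=
    fun s i => C ⟨i % N, Nat.mod_lt _ hN0⟩ (σ i s)
  have hg : ∀ s i, g s i ∈ Ψ (σ i s) := fun s i => hC _ _
  have hg0 : ∀ s i x y, 0 ≤ g s i x y := fun s i => hpos _ _ (hg s i)
  have hgc : ∀ s i, opNorm (g s i) ≤ c := fun s i => hbdd _ _ (hg s i)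
  have hprod : matListProd A =
      seqProd (fun i => hadWMean (fun _ => 1 / (m : ℝ)) fun s => g s i) N := by
    rw [← list_prod_ofFn_eq_seqProd, matListProd]
    congr 2
    funext i
    ext x y
    rw [hCA i]
    simp only [hadWMean, Matrix.of_apply, g, Nat.mod_eq_of_lt i.2]
    exact ((hσ i).prod_comp fun j => C i j x y ^ (1 / (m : ℝ))).symm
  have hY : ∀ s, ∃ Y ∈ setPow (setProd Ψ) k,
      opNorm (seqProd (g s) N) ≤ c ^ (2 * m) * opNorm Y := fun s => by
    have hs := s.2
    obtain ⟨t, ht⟩ : ∃ t, t + s = m := ⟨m - s, by omega⟩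
    obtain ⟨r, hr⟩ : ∃ r, t + k * m + r = N := ⟨N - (t + k * m), by
      rw [mul_comm k m]; omega⟩
    refine ⟨seqProd (fun i => g s (t + i)) (k * m), ?_, ?_⟩
    · rw [seqProd_mul]
      refine ⟨fun l => seqProd (fun i => g s (t + (l * m + i))) m, fun l => ?_,
        (list_prod_ofFn_eq_seqProd
          (fun l => seqProd (fun i => g s (t + (l * m + i))) m) k).symm⟩
      refine ⟨fun i => g s (t + (l * m + i)), fun i => ?_,
        (list_prod_ofFn_eq_seqProd (fun i => g s (t + (l * m + i))) m).symm⟩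
      have hi : σ (t + (l * m + i)) s = i := Fin.ext <| by
        have : t + (l * m + i) + s = i + m * (l + 1) := by
          rw [mul_add, mul_comm m]; omega
        simp only [σ, this, Nat.add_mul_mod_self_left, Nat.mod_eq_of_lt i.2]
      simpa only [hi] using hg s (t + (l * m + i))
    · set Z := seqProd (fun i => g s (t + i)) (k * m)
      have hsplit : seqProd (g s) N =
          seqProd (g s) t * Z * seqProd (fun i => g s (t + k * m + i)) r := by
        rw [← seqProd_add, ← seqProd_add, hr]
      have h1 := opNorm_seqProd_le hc0 (hgc s) t
      have h2 := opNorm_seqProd_le hc0 (fun i => hgc s (t + k * m + i)) r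
      have hZ : 0 ≤ opNorm Z := opNorm_nonneg _
      calc opNorm (seqProd (g s) N)
          ≤ opNorm (seqProd (g s) t * Z) *
              opNorm (seqProd (fun i => g s (t + k * m + i)) r) :=
            hsplit ▸ opNorm_mul_le _ _
        _ ≤ (c ^ t * opNorm Z) * c ^ r := by
            refine mul_le_mul ((opNorm_mul_le _ _).trans ?_) h2 (opNorm_nonneg _) (by positivity)
            exact mul_le_mul_of_nonneg_right h1 hZ
        _ = c ^ (t + r) * opNorm Z := by ring
        _ ≤ c ^ (2 * m) * opNorm Z := by
            refine mul_le_mul_of_nonneg_right (pow_le_pow_right₀ hc ?_) hZ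
            rw [mul_comm k m] at hr
            omega
  choose Y hYmem hYle using hY
  have : Nonempty (Fin m) := ⟨⟨0, hm⟩⟩
  obtain ⟨s₀, hs₀⟩ := Finite.exists_max fun s => opNorm (Y s)
  refine ⟨Y s₀, hYmem s₀, ?_⟩
  have hm' : (m : ℝ) ≠ 0 := by positivity
  have hb0 : 0 ≤ c ^ (2 * m) * opNorm (Y s₀) := mul_nonneg (by positivity) (opNorm_nonneg _)
  rw [hprod, mul_assoc]
  refine opNorm_le_of_abs_entry_le _ hb0 fun x y => ?_
  rw [abs_of_nonneg (seqProd_entry_nonneg (fun i => hadWMean_entry_nonneg _ fun s => hg0 s i) N x y)]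
  refine (seqProd_hadWMean_entry_le _ (fun _ => by positivity) (by simp [hm']) g hg0 N x y).trans ?_
  calc ∏ s, seqProd (g s) N x y ^ (1 / (m : ℝ))
      ≤ ∏ _s : Fin m, (c ^ (2 * m) * opNorm (Y s₀)) ^ (1 / (m : ℝ)) := by
        refine Finset.prod_le_prod
          (fun s _ => Real.rpow_nonneg (seqProd_entry_nonneg (hg0 s) N x y) _) fun s _ => ?_
        refine Real.rpow_le_rpow (seqProd_entry_nonneg (hg0 s) N x y) ?_ (by positivity)
        refine (le_abs_self _).trans ((abs_entry_le_opNorm _ x y).trans ((hYle s).trans ?_))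
        exact mul_le_mul_of_nonneg_left (hs₀ s) (by positivity)
    _ = c ^ (2 * m) * opNorm (Y s₀) := by
        rw [Finset.prod_const, Finset.card_univ, Fintype.card_fin, ← Real.rpow_natCast,
          ← Real.rpow_mul hb0, one_div_mul_cancel hm', Real.rpow_one]

theorem ENNReal.tendsto_const_rpow_one_div_natCast {c : ℝ≥0∞} (h0 : c ≠ 0) (htop : c ≠ ⊤) :
    Filter.Tendsto (fun N : ℕ => c ^ (1 / (N : ℝ))) Filter.atTop (nhds 1) := by
  have hpos : 0 < c.toReal := ENNReal.toReal_pos h0 htop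
  have h : Filter.Tendsto (fun N : ℕ => c.toReal ^ (1 / (N : ℝ))) Filter.atTop
      (nhds (c.toReal ^ (0 : ℝ))) :=
    (Real.continuousAt_const_rpow hpos.ne').tendsto.comp tendsto_one_div_atTop_nhds_zero_nat
  rw [Real.rpow_zero] at h
  simpa [← ENNReal.ofReal_rpow_of_pos hpos, ENNReal.ofReal_toReal htop] using
    ENNReal.tendsto_ofReal h

/-- If `b N` is bounded by a constant times `a (N / m - 1)`, the exponential growth rate of `b`
is at most the `m`-th root of that of `a`. -/
theorem limsup_rpow_one_div_le_of_le_mul {a b : ℕ → ℝ≥0∞} {m : ℕ} (hm : 0 < m) {D : ℝ≥0∞}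
    (hD : D ≠ ⊤) (h : ∀ N, m ≤ N → b N ≤ D * a (N / m - 1)) :
    Filter.atTop.limsup (fun N : ℕ => b N ^ (1 / (N : ℝ))) ≤
      Filter.atTop.limsup (fun k : ℕ => a k ^ (1 / (k : ℝ))) ^ (1 / (m : ℝ)) := by
  have hm' : 0 < (m : ℝ) := by exact_mod_cast hm
  rw [one_div (m : ℝ), ENNReal.le_rpow_inv_iff hm']
  refine le_of_forall_gt_imp_ge_of_dense fun r hr => ?_
  rcases eq_or_ne r ⊤ with rfl | hrtop
  · exact le_top
  have hr0 : r ≠ 0 := (bot_le.trans_lt hr).ne'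
  rw [← ENNReal.le_rpow_inv_iff hm']
  set q := r ^ (m : ℝ)⁻¹ with hq
  have hqm : q ^ m = r := by
    rw [hq, ← ENNReal.rpow_natCast, ENNReal.rpow_inv_rpow hm'.ne']
  have hq0 : q ≠ 0 := by rintro h0; rw [h0, zero_pow hm.ne'] at hqm; exact hr0 hqm.symm
  have hqtop : q ≠ ⊤ := ENNReal.rpow_ne_top_of_nonneg (by positivity) hrtop
  have ha : ∀ᶠ k : ℕ in Filter.atTop, a k ≤ r ^ k := by
    filter_upwards [Filter.eventually_lt_of_limsup_lt hr, Filter.eventually_gt_atTop 0]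
      with k hk hk0
    have hk' : 0 < (k : ℝ) := by exact_mod_cast hk0
    rw [one_div] at hk
    rw [← ENNReal.rpow_natCast]
    exact (ENNReal.rpow_inv_le_iff hk').1 hk.le
  have htend : Filter.Tendsto (fun N : ℕ => N / m - 1) Filter.atTop Filter.atTop :=
    (Filter.tendsto_sub_atTop_nat 1).comp (Nat.tendsto_div_const_atTop hm.ne')
  set E := D * (1 + q⁻¹) ^ (2 * m) + 1 with hE
  have hE0 : E ≠ 0 := by simp [hE]
  have hEtop : E ≠ ⊤ := by
    refine ENNReal.add_ne_top.2 ⟨ENNReal.mul_ne_top hD (ENNReal.pow_ne_top ?_), ENNReal.one_ne_top⟩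
    exact ENNReal.add_ne_top.2 ⟨ENNReal.one_ne_top, ENNReal.inv_ne_top.2 hq0⟩
  have hb : ∀ᶠ N : ℕ in Filter.atTop, b N ^ (1 / (N : ℝ)) ≤ E ^ (1 / (N : ℝ)) * q := by
    filter_upwards [htend.eventually ha, Filter.eventually_ge_atTop m] with N hN hmN
    have hN0 : (N : ℝ) ≠ 0 := by exact_mod_cast (hm.trans_le hmN).ne'
    obtain ⟨j, hj, hjN⟩ : ∃ j, j ≤ 2 * m ∧ m * (N / m - 1) + j = N := by
      have h1 : 0 < N / m := Nat.div_pos hmN hm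
      have h2 := Nat.div_add_mod N m
      have h3 := Nat.mod_lt N hm
      obtain ⟨k, hk⟩ : ∃ k, N / m = k + 1 := ⟨N / m - 1, by omega⟩
      rw [hk, Nat.mul_succ] at h2
      rw [hk, Nat.add_sub_cancel]
      exact ⟨m + N % m, by omega, by omega⟩
    have hpow : r ^ (N / m - 1) = q ^ N * q⁻¹ ^ j := by
      conv_rhs => rw [← hjN]
      rw [pow_add, mul_assoc, ← mul_pow, ENNReal.mul_inv_cancel hq0 hqtop, one_pow, mul_one,
        pow_mul, hqm]
    have hbN : b N ≤ E * q ^ N := by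
      calc b N ≤ D * (q ^ N * q⁻¹ ^ j) := (h N hmN).trans (by rw [← hpow]; gcongr)
        _ ≤ D * (q ^ N * (1 + q⁻¹) ^ (2 * m)) := by
            have hj' : q⁻¹ ^ j ≤ (1 + q⁻¹) ^ (2 * m) :=
              (pow_le_pow_left' le_add_self j).trans (pow_le_pow_right₀ le_self_add hj)
            exact mul_le_mul_right (mul_le_mul_right hj' _) _
        _ = D * (1 + q⁻¹) ^ (2 * m) * q ^ N := by ring
        _ ≤ E * q ^ N := by gcongr; exact le_self_add
    calc b N ^ (1 / (N : ℝ)) ≤ (E * q ^ N) ^ (1 / (N : ℝ)) :=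
          ENNReal.rpow_le_rpow hbN (by positivity)
      _ = E ^ (1 / (N : ℝ)) * q := by
          rw [ENNReal.mul_rpow_of_nonneg _ _ (by positivity), ← ENNReal.rpow_natCast q,
            ← ENNReal.rpow_mul, mul_one_div_cancel hN0, ENNReal.rpow_one]
  have hlim : Filter.Tendsto (fun N : ℕ => E ^ (1 / (N : ℝ)) * q) Filter.atTop (nhds q) := by
    simpa using ENNReal.Tendsto.mul_const
      (ENNReal.tendsto_const_rpow_one_div_natCast hE0 hEtop) (Or.inr hqtop)
  exact (Filter.limsup_le_limsup hb).trans_eq hlim.limsup_eq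

/-- Theorem 3.4, inequality (13), for bounded sets of non-negative matrices:
`ρ̂(Ψ₁^(1/m) ∘ ⋯ ∘ Ψₘ^(1/m)) ≤ ρ̂(Ψ₁ Ψ₂ ⋯ Ψₘ)^(1/m)` for the joint
spectral radius. -/
theorem jointSpecRad_setHadGeomMean_le {m n : ℕ} (hm : 0 < m) (hn : 0 < n)
    (Ψ : Fin m → Set (Matrix (Fin n) (Fin n) ℝ))
    (hne : ∀ j, (Ψ j).Nonempty)
    (hbdd : ∀ j, ∃ C : ℝ, ∀ B ∈ Ψ j, opNorm B ≤ C)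
    (hpos : ∀ j, ∀ B ∈ Ψ j, ∀ x y, 0 ≤ B x y) :
    jointSpecRad (setHadWMean (fun _ => 1 / (m : ℝ)) Ψ) ≤
      jointSpecRad (setProd Ψ) ^ (1 / (m : ℝ)) := by
  choose K hK using hbdd
  let c : ℝ := 1 + ∑ j, |K j|
  have hcK : ∀ j, ∀ B ∈ Ψ j, opNorm B ≤ c := fun j B hB => by
    have h := Finset.single_le_sum (f := fun j => |K j|) (fun i _ => abs_nonneg _)
      (Finset.mem_univ j)
    have h' := (hK j B hB).trans (le_abs_self _)
    exact h'.trans (h.trans (le_add_of_nonneg_left zero_le_one))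
  have hc1 : 1 ≤ c := le_add_of_nonneg_right (Finset.sum_nonneg fun _ _ => abs_nonneg _)
  refine limsup_rpow_one_div_le_of_le_mul hm
    (D := ENNReal.ofReal (n ^ 2 * c ^ (2 * m))) ENNReal.ofReal_ne_top fun N hN => ?_
  refine iSup₂_le fun B hB => ?_
  obtain ⟨Y, hY, hBY⟩ := exists_mem_setPow_setProd_opNorm_le hm hc1 hcK hpos hN hB
  calc ENNReal.ofReal (opNorm B)
      ≤ ENNReal.ofReal (n ^ 2 * c ^ (2 * m)) * ENNReal.ofReal (opNorm Y) := by
        rw [← ENNReal.ofReal_mul (by positivity)]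
        exact ENNReal.ofReal_le_ofReal hBY
    _ ≤ _ := by
        gcongr
        exact le_iSup₂ (f := fun B (_ : B ∈ setPow (setProd Ψ) (N / m - 1)) =>
          ENNReal.ofReal (opNorm B)) Y hY
end

section
/- For each k ≥ 1, let A_k be the bounded linear operator on ℓ²(ℕ, ℂ) defined by (A_k f)(n) = f(k) if n = k+1 and (A_k f)(n) = 0 otherwise (i.e., A_k e_k = e_{k+1} and A_k e_j = 0 for j ≠ k, where (e_j) is the standard orthonormal basis). Then for every k ≥ 1 and all indices i₁, i₂, ..., i_k ≥ 1, the operator (A_{i₁} A_{i₂} ⋯ A_{i_k})² is the zero operator; in particular, the spectral radius of every finite product of the operators A_i is zero. -/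
/-- A nonempty product of the shift units `A_k` is a scalar multiple of a matrix unit
`e_a ↦ e_b` with `a < b`. -/
theorem exists_matrix_unit_of_prod_shift
    (A : ℕ+ → lp (fun _ : ℕ+ => ℂ) 2 →L[ℂ] lp (fun _ : ℕ+ => ℂ) 2)
    (hA : ∀ (k : ℕ+) (f : lp (fun _ : ℕ+ => ℂ) 2) (n : ℕ+),
      A k f n = if n = k + 1 then f k else 0)
    (l : List ℕ+) (hl : l ≠ []) :
    ∃ (a b : ℕ+) (c : ℂ), a < b ∧ ∀ (f : lp (fun _ : ℕ+ => ℂ) 2) (n : ℕ+),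
      (l.map A).prod f n = if n = b then c * f a else 0 := by
  induction l with
  | nil => exact absurd rfl hl
  | cons j l ih =>
    rcases eq_or_ne l [] with rfl | h
    · exact ⟨j, j + 1, 1, PNat.lt_add_right j 1, fun f n => by simp [hA]⟩
    · obtain ⟨a, b, c, hab, hP⟩ := ih h
      by_cases hj : j = b
      · subst hj
        refine ⟨a, j + 1, c, hab.trans (PNat.lt_add_right j 1), fun f n => ?_⟩
        simp [hA, hP]
      · refine ⟨j, j + 1, 0, PNat.lt_add_right j 1, fun f n => ?_⟩
        simp [hA, hP, hj]

/-- In an algebra over a normed field, an element of square zero has spectral radius zero. -/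
theorem spectralRadius_eq_zero_of_sq_eq_zero {𝕜 R : Type*} [NormedField 𝕜] [Ring R]
    [Algebra 𝕜 R] {x : R} (hx : x ^ 2 = 0) : spectralRadius 𝕜 x = 0 := by
  have h := spectrum.spectralRadius_pow_le (𝕜 := 𝕜) x 2 two_ne_zero
  rw [hx, spectrum.spectralRadius_zero] at h
  exact eq_zero_of_pow_eq_zero (le_antisymm h zero_le)


/-- Let `A_k` be the operators on `ℓ²(ℕ⁺, ℂ)` determined by
`(A_k f)(n) = f(k)` if `n = k+1` and `0` otherwise (i.e. `A_k e_k = e_{k+1}`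
and `A_k e_j = 0` for `j ≠ k`).  Then the square of every finite product of
the `A_i` is zero; in particular every such product has spectral radius `0`. -/
theorem sq_prod_shift_eq_zero
    (A : ℕ+ → lp (fun _ : ℕ+ => ℂ) 2 →L[ℂ] lp (fun _ : ℕ+ => ℂ) 2)
    (hA : ∀ (k : ℕ+) (f : lp (fun _ : ℕ+ => ℂ) 2) (n : ℕ+),
      A k f n = if n = k + 1 then f k else 0) :
    ∀ (k : ℕ), 1 ≤ k → ∀ i : Fin k → ℕ+,
      ((List.ofFn fun t => A (i t)).prod) ^ 2 = 0 ∧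
        spectralRadius ℂ ((List.ofFn fun t => A (i t)).prod) = 0 := by
  intro k hk i
  have hsq : ((List.ofFn fun t => A (i t)).prod) ^ 2 = 0 := by
    have hne : List.ofFn i ≠ [] := by
      simpa [List.ofFn_eq_nil_iff] using Nat.one_le_iff_ne_zero.mp hk
    obtain ⟨a, b, c, hab, hP⟩ := exists_matrix_unit_of_prod_shift A hA (List.ofFn i) hne
    have hmap : (List.ofFn i).map A = List.ofFn fun t => A (i t) := List.map_ofFn
    rw [hmap] at hP
    ext f n
    simp [pow_two, hP, hab.ne]
  exact ⟨hsq, spectralRadius_eq_zero_of_sq_eq_zero hsq⟩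
end
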